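/- Let 𝓛 and 𝓛' be real Banach spaces, α₀ ∈ ℝ, (T_t)_{t≥0} and (T'_t)_{t≥0} strongly continuous semigroups on 𝓛 and 𝓛' respectively, both satisfying ‖e^{−α₀ t}T_t‖_op ≤ 1 and ‖e^{−α₀ t}T'_t‖_op ≤ 1, with Laplace-transform resolvents G_α f = ∫₀^∞ e^{−αt}T_t f dt and G'_α g = ∫₀^∞ e^{−αt}T'_t g dt for α > α₀. Let Φ : 𝓛 → 𝓛' be a bounded linear map. Then for every h ∈ 𝓛, every α > α₀ and every t ≥ 0: G'_α (T'_t Φ − Φ T_t) G_α h = ∫₀^t T'_{t−s} (G'_α Φ − Φ G_α) T_s h ds. -/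

import Mathlib

open Filter Topology MeasureTheory

/-- The Laplace-transform resolvent `G_α f = ∫₀^∞ e^{−α t} T_t f dt` of a semigroup `T`. -/
noncomputable def laplaceG {E : Type*} [NormedAddCommGroup E] [NormedSpace ℝ E]
    [CompleteSpace E] (T : ℝ → E →L[ℝ] E) (α : ℝ) (f : E) : E :=
  ∫ t in Set.Ioi (0:ℝ), Real.exp (-α * t) • T t f

/-- Strongly continuous semigroups with `‖e^{-α₀ t} T_t‖ ≤ 1` for `t ≥ 0`. -/
structure IsQuasiContractionSemigroup {E : Type*} [NormedAddCommGroup E] [NormedSpace ℝ E]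
    (α₀ : ℝ) (T : ℝ → E →L[ℝ] E) : Prop where
  zero : T 0 = ContinuousLinearMap.id ℝ E
  add : ∀ s ≥ (0:ℝ), ∀ t ≥ (0:ℝ), T (s + t) = (T s).comp (T t)
  tendsto : ∀ f : E, Tendsto (fun t : ℝ => T t f) (𝓝[>] (0:ℝ)) (𝓝 f)
  norm_le_of_pos : ∀ t > (0:ℝ), ‖T t‖ ≤ Real.exp (α₀ * t)

theorem tendsto_clm_apply_of_norm_le {ι E F : Type*} [NormedAddCommGroup E] [NormedSpace ℝ E]
    [NormedAddCommGroup F] [NormedSpace ℝ F] {l : Filter ι} {R : ι → E →L[ℝ] F} {v : ι → E}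
    {x : E} {y : F} {C : ℝ} (hC : ∀ᶠ i in l, ‖R i‖ ≤ C)
    (hR : Tendsto (fun i => R i x) l (𝓝 y)) (hv : Tendsto v l (𝓝 x)) :
    Tendsto (fun i => R i (v i)) l (𝓝 y) := by
  have hsub : Tendsto (fun i => R i (v i - x)) l (𝓝 0) := by
    refine squeeze_zero_norm' (a := fun i => C * ‖v i - x‖) ?_ ?_
    · filter_upwards [hC] with i hi using (R i).le_of_opNorm_le hi _
    · simpa using (tendsto_iff_norm_sub_tendsto_zero.1 hv).const_mul C
  simpa using hsub.add hR

theorem hasDerivAt_clm_apply_of_strong {E F : Type*} [NormedAddCommGroup E] [NormedSpace ℝ E]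
    [NormedAddCommGroup F] [NormedSpace ℝ F] {R : ℝ → E →L[ℝ] F} {v : ℝ → E} {s C : ℝ}
    {v' : E} {w : F} (hC : ∀ᶠ r in 𝓝 s, ‖R r‖ ≤ C) (hR : ContinuousAt (fun r => R r v') s)
    (hRv : HasDerivAt (fun r => R r (v s)) w s) (hv : HasDerivAt v v' s) :
    HasDerivAt (fun r => R r (v r)) (R s v' + w) s := by
  rw [hasDerivAt_iff_tendsto_slope] at hRv hv ⊢
  have hlim := tendsto_clm_apply_of_norm_le (hC.filter_mono nhdsWithin_le_nhds)
    (hR.mono_left nhdsWithin_le_nhds) hv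
  refine (hlim.add hRv).congr fun r => ?_
  simp only [slope_def_module, map_smul, map_sub, ← smul_add]
  congr 1
  abel

namespace IsQuasiContractionSemigroup

variable {E : Type*} [NormedAddCommGroup E] [NormedSpace ℝ E] {α₀ α : ℝ} {T : ℝ → E →L[ℝ] E}

theorem norm_le (hT : IsQuasiContractionSemigroup α₀ T) {t : ℝ} (ht : 0 ≤ t) :
    ‖T t‖ ≤ Real.exp (α₀ * t) := by
  rcases ht.eq_or_lt with rfl | ht
  · simpa [hT.zero] using ContinuousLinearMap.norm_id_le
  · exact hT.norm_le_of_pos t ht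

theorem add_apply (hT : IsQuasiContractionSemigroup α₀ T) {s t : ℝ} (hs : 0 ≤ s) (ht : 0 ≤ t)
    (f : E) : T (s + t) f = T s (T t f) := by
  rw [hT.add s hs t ht, ContinuousLinearMap.comp_apply]

theorem norm_sub_le (hT : IsQuasiContractionSemigroup α₀ T) {a b : ℝ} (ha : 0 ≤ a) (hb : 0 ≤ b)
    (f : E) : ‖T a f - T b f‖ ≤ Real.exp (α₀ * min a b) * ‖T |a - b| f - f‖ := by
  wlog hab : b ≤ a generalizing a b
  · rw [norm_sub_rev, min_comm, abs_sub_comm]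
    exact this hb ha (le_of_not_ge hab)
  have h := hT.add_apply hb (sub_nonneg.2 hab) f
  rw [add_sub_cancel] at h
  rw [h, ← map_sub, min_eq_right hab, abs_of_nonneg (sub_nonneg.2 hab)]
  exact (T b).le_of_opNorm_le (hT.norm_le hb) _

theorem tendsto_abs (hT : IsQuasiContractionSemigroup α₀ T) (f : E) :
    Tendsto (fun x : ℝ => T |x| f) (𝓝 0) (𝓝 f) := by
  have h : ContinuousWithinAt (fun t => T t f) (Set.Ici 0) 0 := by
    rw [← Set.Ioi_insert, continuousWithinAt_insert_self]
    simpa [ContinuousWithinAt, hT.zero] using hT.tendsto f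
  have h0 : Tendsto (fun t => T t f) (𝓝[≥] 0) (𝓝 f) := by
    simpa [ContinuousWithinAt, hT.zero] using h
  refine h0.comp (tendsto_nhdsWithin_iff.2 ⟨?_, Eventually.of_forall fun x => abs_nonneg x⟩)
  simpa using (continuous_abs (G := ℝ)).tendsto 0

theorem continuous_max (hT : IsQuasiContractionSemigroup α₀ T) (f : E) :
    Continuous fun t : ℝ => T (max t 0) f := by
  refine continuous_iff_continuousAt.2 fun b => tendsto_iff_norm_sub_tendsto_zero.2 ?_
  refine squeeze_zero (fun _ => norm_nonneg _)
    (fun a => hT.norm_sub_le (le_max_right a 0) (le_max_right b 0) f) ?_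
  have h1 : Tendsto (fun a : ℝ => max a 0 - max b 0) (𝓝 b) (𝓝 0) := by
    have : Continuous fun a : ℝ => max a 0 - max b 0 := by fun_prop
    simpa using this.tendsto b
  have h2 : Continuous fun a : ℝ => Real.exp (α₀ * min (max a 0) (max b 0)) := by fun_prop
  simpa using (h2.tendsto b).mul
    (tendsto_iff_norm_sub_tendsto_zero.1 ((hT.tendsto_abs f).comp h1))

theorem eventually_norm_le (hT : IsQuasiContractionSemigroup α₀ T) (r : ℝ) :
    ∀ᶠ x in 𝓝 r, ‖T (max x 0)‖ ≤ Real.exp (α₀ * max r 0) + 1 := by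
  have h : Continuous fun x : ℝ => Real.exp (α₀ * max x 0) := by fun_prop
  filter_upwards [(h.tendsto r).eventually_le_const (lt_add_one _)] with x hx
  exact (hT.norm_le (le_max_right x 0)).trans hx

theorem continuous_apply (hT : IsQuasiContractionSemigroup α₀ T) {X : Type*} [TopologicalSpace X]
    {r : X → ℝ} {v : X → E} (hr : Continuous r) (hv : Continuous v) :
    Continuous fun x => T (max (r x) 0) (v x) :=
  continuous_iff_continuousAt.2 fun x =>
    tendsto_clm_apply_of_norm_le ((hr.tendsto x).eventually (hT.eventually_norm_le (r x)))
      (((hT.continuous_max (v x)).comp hr).tendsto x) (hv.tendsto x)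

theorem norm_exp_smul_le (hT : IsQuasiContractionSemigroup α₀ T) {t : ℝ} (ht : 0 ≤ t) (f : E) :
    ‖Real.exp (-α * t) • T t f‖ ≤ ‖f‖ * Real.exp (-(α - α₀) * t) := by
  have h : Real.exp (-(α - α₀) * t) = Real.exp (-α * t) * Real.exp (α₀ * t) := by
    rw [← Real.exp_add]
    ring_nf
  rw [norm_smul, Real.norm_of_nonneg (Real.exp_nonneg _), h, mul_comm ‖f‖, mul_assoc]
  gcongr
  exact (T t).le_of_opNorm_le (hT.norm_le ht) f

theorem integrableOn (hT : IsQuasiContractionSemigroup α₀ T) (hα : α₀ < α) (f : E) :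
    IntegrableOn (fun t => Real.exp (-α * t) • T t f) (Set.Ioi 0) := by
  refine Integrable.mono' ((integrableOn_exp_mul_Ioi (a := -(α - α₀)) (by linarith) 0).const_mul ‖f‖)
    ?_ ?_
  · have h : Continuous fun t => Real.exp (-α * t) • T (max t 0) f :=
      (by fun_prop : Continuous fun t => Real.exp (-α * t)).smul (hT.continuous_max f)
    refine h.aestronglyMeasurable.congr ?_
    filter_upwards [ae_restrict_mem measurableSet_Ioi] with t ht
    rw [max_eq_left (le_of_lt ht)]
  · filter_upwards [ae_restrict_mem measurableSet_Ioi] with t ht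
    exact hT.norm_exp_smul_le (le_of_lt ht) f

variable [CompleteSpace E]

theorem laplaceG_add (hT : IsQuasiContractionSemigroup α₀ T) (hα : α₀ < α) (f g : E) :
    laplaceG T α (f + g) = laplaceG T α f + laplaceG T α g := by
  simp only [laplaceG, map_add, smul_add]
  exact integral_add (hT.integrableOn hα f) (hT.integrableOn hα g)

theorem norm_laplaceG_le (hT : IsQuasiContractionSemigroup α₀ T) (hα : α₀ < α) (f : E) :
    ‖laplaceG T α f‖ ≤ (∫ t in Set.Ioi (0:ℝ), Real.exp (-(α - α₀) * t)) * ‖f‖ := by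
  rw [mul_comm, ← integral_const_mul]
  refine norm_integral_le_of_norm_le
    ((integrableOn_exp_mul_Ioi (a := -(α - α₀)) (by linarith) 0).const_mul ‖f‖) ?_
  filter_upwards [ae_restrict_mem measurableSet_Ioi] with t ht
  exact hT.norm_exp_smul_le (le_of_lt ht) f

theorem exists_clm_eq_laplaceG (hT : IsQuasiContractionSemigroup α₀ T) (hα : α₀ < α) :
    ∃ G : E →L[ℝ] E, ∀ f, G f = laplaceG T α f := by
  refine ⟨LinearMap.mkContinuous
    { toFun := laplaceG T α
      map_add' := hT.laplaceG_add hα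
      map_smul' := fun c f => ?_ } _ (hT.norm_laplaceG_le hα), fun _ => rfl⟩
  simp only [laplaceG, map_smul, smul_comm _ c]
  exact integral_smul c _

theorem apply_laplaceG (hT : IsQuasiContractionSemigroup α₀ T) (hα : α₀ < α) {t : ℝ}
    (ht : 0 ≤ t) (f : E) : T t (laplaceG T α f) = laplaceG T α (T t f) := by
  rw [laplaceG, laplaceG, ← ContinuousLinearMap.integral_comp_comm _ (hT.integrableOn hα f)]
  refine setIntegral_congr_fun measurableSet_Ioi fun u hu => ?_
  have hu : 0 ≤ u := le_of_lt hu
  simp only [map_smul]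
  rw [← hT.add_apply ht hu, ← hT.add_apply hu ht, add_comm]

theorem laplaceG_apply (hT : IsQuasiContractionSemigroup α₀ T) (hα : α₀ < α) {t : ℝ}
    (ht : 0 ≤ t) (f : E) : laplaceG T α (T t f) = Real.exp (α * t) •
      (laplaceG T α f - ∫ u in (0:ℝ)..t, Real.exp (-α * u) • T (max u 0) f) := by
  have h1 : ∫ u in (0:ℝ)..t, Real.exp (-α * u) • T (max u 0) f
      = ∫ u in (0:ℝ)..t, Real.exp (-α * u) • T u f := by
    refine intervalIntegral.integral_congr fun u hu => ?_
    rw [Set.uIcc_of_le ht] at hu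
    simp only [max_eq_left hu.1]
  have h2 : laplaceG T α f - ∫ u in (0:ℝ)..t, Real.exp (-α * u) • T u f
      = ∫ u in Set.Ioi t, Real.exp (-α * u) • T u f := by
    rw [laplaceG, ← intervalIntegral.integral_Ioi_sub_Ioi (hT.integrableOn hα f) ht, sub_sub_cancel]
  have h3 := (measurePreserving_add_right volume t).setIntegral_preimage_emb
    (measurableEmbedding_addRight t) (fun u => Real.exp (α * t) • Real.exp (-α * u) • T u f)
    (Set.Ioi t)
  rw [Set.preimage_add_const_Ioi, sub_self] at h3
  rw [h1, h2, ← integral_smul, ← h3, laplaceG]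
  refine setIntegral_congr_fun measurableSet_Ioi fun u hu => ?_
  have hu : 0 ≤ u := le_of_lt hu
  rw [smul_smul, ← Real.exp_add, hT.add_apply hu ht]
  ring_nf

theorem hasDerivAt_laplaceG_apply (hT : IsQuasiContractionSemigroup α₀ T) (hα : α₀ < α) {t : ℝ}
    (ht : 0 < t) (f : E) : HasDerivAt (fun s => laplaceG T α (T (max s 0) f))
      (α • laplaceG T α (T t f) - T t f) t := by
  have hc : Continuous fun t => Real.exp (-α * t) • T (max t 0) f :=
    (by fun_prop : Continuous fun t => Real.exp (-α * t)).smul (hT.continuous_max f)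
  have hint := (hc.integral_hasStrictDerivAt 0 t).hasDerivAt.const_sub (laplaceG T α f)
  have hexp : HasDerivAt (fun s => Real.exp (α * s)) (Real.exp (α * t) * α) t := by
    simpa using ((hasDerivAt_id t).const_mul α).exp
  have h := hexp.smul hint
  refine (h.congr_of_eventuallyEq ?_).congr_deriv ?_
  · filter_upwards [lt_mem_nhds ht] with s hs
    simp only [max_eq_left hs.le, hT.laplaceG_apply hα hs.le]
    rfl
  · rw [hT.laplaceG_apply hα ht.le, max_eq_left ht.le, smul_neg, smul_smul, smul_smul,
      ← Real.exp_add, mul_comm α (Real.exp _), neg_mul, add_neg_cancel, Real.exp_zero, one_smul]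
    abel

end IsQuasiContractionSemigroup

/-- Let `(T_t)` and `(T'_t)` be strongly continuous semigroups on the real
Banach spaces `𝓛`, `𝓛'` with `‖e^{−α₀ t}T_t‖ ≤ 1`, `‖e^{−α₀ t}T'_t‖ ≤ 1`, with
Laplace-transform resolvents `G_α`, `G'_α`, and let `Φ : 𝓛 → 𝓛'` be a bounded linear map.
Then for every `h ∈ 𝓛`, `α > α₀` and `t ≥ 0`:
`G'_α (T'_t Φ − Φ T_t) G_α h = ∫₀^t T'_{t−s} (G'_α Φ − Φ G_α) T_s h ds`. -/
theorem resolvent_semigroup_commutator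
    {L : Type*} [NormedAddCommGroup L] [NormedSpace ℝ L] [CompleteSpace L]
    {L' : Type*} [NormedAddCommGroup L'] [NormedSpace ℝ L'] [CompleteSpace L']
    (α₀ : ℝ) (T : ℝ → L →L[ℝ] L) (T' : ℝ → L' →L[ℝ] L')
    (hT0 : T 0 = ContinuousLinearMap.id ℝ L)
    (hTsemi : ∀ s ≥ (0:ℝ), ∀ t ≥ (0:ℝ), T (s + t) = (T s).comp (T t))
    (hTcont : ∀ f : L, Tendsto (fun t : ℝ => T t f) (𝓝[>] (0:ℝ)) (𝓝 f))
    (hTnorm : ∀ t > (0:ℝ), ‖T t‖ ≤ Real.exp (α₀ * t))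
    (hT'0 : T' 0 = ContinuousLinearMap.id ℝ L')
    (hT'semi : ∀ s ≥ (0:ℝ), ∀ t ≥ (0:ℝ), T' (s + t) = (T' s).comp (T' t))
    (hT'cont : ∀ g : L', Tendsto (fun t : ℝ => T' t g) (𝓝[>] (0:ℝ)) (𝓝 g))
    (hT'norm : ∀ t > (0:ℝ), ‖T' t‖ ≤ Real.exp (α₀ * t))
    (Φ : L →L[ℝ] L') :
    ∀ h : L, ∀ α > α₀, ∀ t ≥ (0:ℝ),
      laplaceG T' α (T' t (Φ (laplaceG T α h)) - Φ (T t (laplaceG T α h)))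
        = ∫ s in (0:ℝ)..t,
            T' (t - s) (laplaceG T' α (Φ (T s h)) - Φ (laplaceG T α (T s h))) := by
  intro h α hα t ht
  have hT : IsQuasiContractionSemigroup α₀ T := ⟨hT0, hTsemi, hTcont, hTnorm⟩
  have hT' : IsQuasiContractionSemigroup α₀ T' := ⟨hT'0, hT'semi, hT'cont, hT'norm⟩
  obtain ⟨G, hG⟩ := hT.exists_clm_eq_laplaceG hα
  obtain ⟨G', hG'⟩ := hT'.exists_clm_eq_laplaceG hα
  have hcomm : ∀ s, 0 ≤ s → ∀ f, T s (G f) = G (T s f) := fun s hs f => by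
    simpa only [hG] using hT.apply_laplaceG hα hs f
  have hcomm' : ∀ s, 0 ≤ s → ∀ g, T' s (G' g) = G' (T' s g) := fun s hs g => by
    simpa only [hG'] using hT'.apply_laplaceG hα hs g
  simp only [← hG, ← hG']
  have hr : Continuous fun s : ℝ => t - s := by fun_prop
  have hS : Continuous fun s : ℝ => T (max s 0) h := hT.continuous_max h
  have hΦG : Continuous fun s : ℝ => Φ (G (T (max s 0) h)) := (Φ ∘L G).continuous.comp hS
  have hcont : Continuous fun s => T' (max (t - s) 0) (G' (Φ (G (T (max s 0) h)))) :=
    hT'.continuous_apply hr (G'.continuous.comp hΦG)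
  have hcont' : Continuous fun s => T' (max (t - s) 0)
      (Φ (G (T (max s 0) h)) - G' (Φ (T (max s 0) h))) :=
    hT'.continuous_apply hr (hΦG.sub ((G' ∘L Φ).continuous.comp hS))
  have hderiv : ∀ s ∈ Set.Ioo 0 t,
      HasDerivAt (fun s => T' (max (t - s) 0) (G' (Φ (G (T (max s 0) h)))))
        (T' (max (t - s) 0) (Φ (G (T (max s 0) h)) - G' (Φ (T (max s 0) h)))) s := by
    intro s hs
    have hts : 0 < t - s := sub_pos.2 hs.2
    have hU : HasDerivAt (fun s => G (T (max s 0) h)) (α • G (T s h) - T s h) s := by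
      simpa only [hG] using hT.hasDerivAt_laplaceG_apply hα hs.1 h
    have hv := ((G' ∘L Φ).hasFDerivAt.comp_hasDerivAt s hU)
    have hR : HasDerivAt (fun r => T' (max r 0) (G' (Φ (G (T (max s 0) h)))))
        (α • G' (T' (t - s) (Φ (G (T (max s 0) h)))) - T' (t - s) (Φ (G (T (max s 0) h))))
        (t - s) := by
      have := hT'.hasDerivAt_laplaceG_apply hα hts (Φ (G (T (max s 0) h)))
      simp only [← hG'] at this
      simpa only [hcomm' _ (le_max_right _ _)] using this
    have hprod := hasDerivAt_clm_apply_of_strong (R := fun r => T' (max (t - r) 0))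
      ((hr.tendsto s).eventually (hT'.eventually_norm_le (t - s)))
      ((hT'.continuous_max _).comp hr).continuousAt (hR.scomp s ((hasDerivAt_id s).const_sub t)) hv
    refine hprod.congr_deriv ?_
    simp only [max_eq_left hs.1.le, max_eq_left hts.le, ContinuousLinearMap.comp_apply, map_sub,
      map_smul, hcomm' _ hts.le, neg_smul, one_smul]
    abel
  have hFTC := intervalIntegral.integral_eq_sub_of_hasDerivAt_of_le ht hcont.continuousOn hderiv
    (hcont'.intervalIntegrable 0 t)
  have hint : ∫ s in (0:ℝ)..t, T' (t - s) (G' (Φ (T s h)) - Φ (G (T s h)))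
      = -∫ s in (0:ℝ)..t, T' (max (t - s) 0)
          (Φ (G (T (max s 0) h)) - G' (Φ (T (max s 0) h))) := by
    rw [← intervalIntegral.integral_neg]
    refine intervalIntegral.integral_congr fun s hs => ?_
    rw [Set.uIcc_of_le ht] at hs
    simp only [max_eq_left hs.1, max_eq_left (sub_nonneg.2 hs.2), ← map_neg, neg_sub]
  rw [hint, hFTC, neg_sub]
  simp only [sub_zero, sub_self, max_self, max_eq_left ht, hT0, hT'0, map_sub, hcomm t ht,
    hcomm' t ht, ContinuousLinearMap.id_apply]
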